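/- Let U be uniformly distributed on S^{d-1}. Then for all b, c ∈ S^{d-1}, E[(b·U)⁶(c·U)⁶] = (720(b·c)⁶ + 5400(b·c)⁴ + 4050(b·c)² + 225) / (d(d+2)(d+4)(d+6)(d+8)(d+10)). -/

import Mathlib

open MeasureTheory Real
open scoped InnerProductSpace

/-- The spherical Lebesgue (surface) measure `σ` on the unit sphere
`S^{d-1} = {x ∈ ℝ^d : ‖x‖ = 1}`. -/
noncomputable def sphereMeasure (d : ℕ) :
    Measure (Metric.sphere (0 : EuclideanSpace ℝ (Fin d)) 1) :=
  (volume : Measure (EuclideanSpace ℝ (Fin d))).toSphere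

/-- Expectation `E g(U) = |S^{d-1}|⁻¹ ∫_{S^{d-1}} g(u) dσ(u)` of `g(U)` for `U`
uniformly distributed on the sphere `S^{d-1}`. -/
noncomputable def unifExp (d : ℕ)
    (g : Metric.sphere (0 : EuclideanSpace ℝ (Fin d)) 1 → ℝ) : ℝ :=
  ((sphereMeasure d) Set.univ).toReal⁻¹ * ∫ u, g u ∂(sphereMeasure d)

/-- The `k`-th moment `∫ xᵏ exp(-x²/2) dx` of the Gaussian weight on the real line. -/
noncomputable def gaussianMoment (k : ℕ) : ℝ :=
  ∫ x : ℝ, x ^ k * exp (-(1 / 2) * x ^ 2)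

/-- The `k`-th moment `∫ xᵏ exp(-x²/2) dx` of the Gaussian weight on the half-line `(0, ∞)`. -/
noncomputable def halfGaussianMoment (k : ℕ) : ℝ :=
  ∫ x in Set.Ioi (0 : ℝ), x ^ k * exp (-(1 / 2) * x ^ 2)

lemma halfGaussianMoment_eq (k : ℕ) :
    halfGaussianMoment k =
      (1 / 2 : ℝ) ^ (-((k : ℝ) + 1) / 2) * (1 / 2) * Gamma (((k : ℝ) + 1) / 2) := by
  have h := integral_rpow_mul_exp_neg_mul_rpow (p := 2) (q := k) (b := 1 / 2) two_pos
    (by have := k.cast_nonneg (α := ℝ); linarith) (by norm_num)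
  rw [← h, halfGaussianMoment]
  norm_cast

lemma halfGaussianMoment_pos (k : ℕ) : 0 < halfGaussianMoment k := by
  rw [halfGaussianMoment_eq]
  have : 0 < Gamma (((k : ℝ) + 1) / 2) := Gamma_pos_of_pos (by positivity)
  positivity

lemma halfGaussianMoment_add_two (k : ℕ) :
    halfGaussianMoment (k + 2) = (k + 1) * halfGaussianMoment k := by
  have hk : ((k : ℝ) + 1) / 2 ≠ 0 := by positivity
  rw [halfGaussianMoment_eq, halfGaussianMoment_eq]
  have h1 : (((k + 2 : ℕ) : ℝ) + 1) / 2 = ((k : ℝ) + 1) / 2 + 1 := by push_cast; ring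
  have h2 : -(((k + 2 : ℕ) : ℝ) + 1) / 2 = -((k : ℝ) + 1) / 2 + (-1 : ℝ) := by push_cast; ring
  rw [h1, h2, Gamma_add_one hk, rpow_add (by norm_num), rpow_neg_one]
  ring

lemma gaussianMoment_of_even {k : ℕ} (hk : Even k) :
    gaussianMoment k = 2 * halfGaussianMoment k := by
  rw [gaussianMoment, halfGaussianMoment, ← integral_comp_abs]
  simp only [hk.pow_abs, sq_abs]

lemma gaussianMoment_of_odd {k : ℕ} (hk : Odd k) : gaussianMoment k = 0 := by
  have h := integral_neg_eq_self (fun x : ℝ => x ^ k * exp (-(1 / 2) * x ^ 2)) volume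
  simp only [hk.neg_pow, neg_sq, neg_mul, integral_neg] at h
  simp only [gaussianMoment, neg_mul]
  linarith

lemma gaussianMoment_add_two (k : ℕ) :
    gaussianMoment (k + 2) = (k + 1) * gaussianMoment k := by
  rcases k.even_or_odd with hk | hk
  · rw [gaussianMoment_of_even hk, gaussianMoment_of_even (hk.add even_two),
      halfGaussianMoment_add_two]
    ring
  · rw [gaussianMoment_of_odd hk, gaussianMoment_of_odd (hk.add_even even_two), mul_zero]

lemma integrable_pow_mul_exp_neg_half_mul_sq (k : ℕ) :
    Integrable (fun x : ℝ => x ^ k * exp (-(1 / 2) * x ^ 2)) := by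
  have h := integrable_rpow_mul_exp_neg_mul_sq (b := 1 / 2) (by norm_num) (s := k)
    (by have := k.cast_nonneg (α := ℝ); linarith)
  simpa only [rpow_natCast] using h

section EuclideanMoments

variable {ι : Type*} [Fintype ι]

lemma prod_pow_mul_exp_neg_half_mul_sq (a : ι → ℕ) (x : ι → ℝ) :
    (∏ i, x i ^ a i) * exp (-(1 / 2) * ‖WithLp.toLp 2 x‖ ^ 2) =
      ∏ i, x i ^ a i * exp (-(1 / 2) * x i ^ 2) := by
  rw [Finset.prod_mul_distrib, ← exp_sum, EuclideanSpace.norm_sq_eq, Finset.mul_sum]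
  simp

lemma integrable_monomial_mul_gaussian (a : ι → ℕ) :
    Integrable fun x : EuclideanSpace ℝ ι =>
      (∏ i, x i ^ a i) * exp (-(1 / 2) * ‖x‖ ^ 2) := by
  rw [← (PiLp.volume_preserving_toLp ι).integrable_comp_emb
    (MeasurableEquiv.toLp 2 (ι → ℝ)).measurableEmbedding]
  simp only [Function.comp_def, prod_pow_mul_exp_neg_half_mul_sq]
  exact Integrable.fintype_prod (f := fun i (t : ℝ) => t ^ a i * exp (-(1 / 2) * t ^ 2))
    fun i => integrable_pow_mul_exp_neg_half_mul_sq (a i)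

lemma integral_monomial_mul_gaussian (a : ι → ℕ) :
    ∫ x : EuclideanSpace ℝ ι, (∏ i, x i ^ a i) * exp (-(1 / 2) * ‖x‖ ^ 2) =
      ∏ i, gaussianMoment (a i) := by
  rw [← (PiLp.volume_preserving_toLp ι).integral_comp
    (MeasurableEquiv.toLp 2 (ι → ℝ)).measurableEmbedding]
  simp only [prod_pow_mul_exp_neg_half_mul_sq]
  exact integral_fintype_prod_volume_eq_prod fun i (t : ℝ) => t ^ a i * exp (-(1 / 2) * t ^ 2)

end EuclideanMoments

section TwoCoordinates

variable {n : ℕ}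

lemma prod_pow_cons_cons_zero (k l : ℕ) (x : Fin (n + 2) → ℝ) :
    ∏ i, x i ^ (Fin.cons k (Fin.cons l 0 : Fin (n + 1) → ℕ) : Fin (n + 2) → ℕ) i =
      x 0 ^ k * x 1 ^ l := by
  simp [Fin.prod_univ_succ, Fin.succ_zero_eq_one]

lemma integrable_pow_mul_pow_mul_gaussian (k l : ℕ) :
    Integrable fun x : EuclideanSpace ℝ (Fin (n + 2)) =>
      x 0 ^ k * x 1 ^ l * exp (-(1 / 2) * ‖x‖ ^ 2) := by
  simpa only [prod_pow_cons_cons_zero] using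
    integrable_monomial_mul_gaussian
      (Fin.cons k (Fin.cons l 0 : Fin (n + 1) → ℕ) : Fin (n + 2) → ℕ)

lemma integral_pow_mul_pow_mul_gaussian (k l : ℕ) :
    ∫ x : EuclideanSpace ℝ (Fin (n + 2)), x 0 ^ k * x 1 ^ l * exp (-(1 / 2) * ‖x‖ ^ 2) =
      gaussianMoment k * gaussianMoment l * gaussianMoment 0 ^ n := by
  have h := integral_monomial_mul_gaussian
    (Fin.cons k (Fin.cons l 0 : Fin (n + 1) → ℕ) : Fin (n + 2) → ℕ)
  simp only [prod_pow_cons_cons_zero] at h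
  rw [h]
  simp [Fin.prod_univ_succ, mul_assoc]

lemma integral_pow_six_mul_linear_pow_six_mul_gaussian {p q : ℝ} (hpq : p ^ 2 + q ^ 2 = 1) :
    ∫ x : EuclideanSpace ℝ (Fin (n + 2)),
        x 0 ^ 6 * (p * x 0 + q * x 1) ^ 6 * exp (-(1 / 2) * ‖x‖ ^ 2) =
      (720 * p ^ 6 + 5400 * p ^ 4 + 4050 * p ^ 2 + 225) * gaussianMoment 0 ^ (n + 2) := by
  have hexpand : ∀ x : EuclideanSpace ℝ (Fin (n + 2)),
      x 0 ^ 6 * (p * x 0 + q * x 1) ^ 6 * exp (-(1 / 2) * ‖x‖ ^ 2) =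
        ∑ k ∈ Finset.range 7, p ^ k * q ^ (6 - k) * (Nat.choose 6 k : ℝ) *
          (x 0 ^ (6 + k) * x 1 ^ (6 - k) * exp (-(1 / 2) * ‖x‖ ^ 2)) := by
    intro x
    rw [add_pow, Finset.mul_sum, Finset.sum_mul]
    refine Finset.sum_congr rfl fun k _ => ?_
    ring
  simp only [hexpand]
  rw [integral_finsetSum _ fun k _ => (integrable_pow_mul_pow_mul_gaussian _ _).const_mul _]
  simp only [integral_const_mul, integral_pow_mul_pow_mul_gaussian, Finset.sum_range_succ,
    Finset.sum_range_zero]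
  have h1 : gaussianMoment 1 = 0 := gaussianMoment_of_odd (by decide)
  have h3 : gaussianMoment 3 = 0 := gaussianMoment_of_odd (by decide)
  have h5 : gaussianMoment 5 = 0 := gaussianMoment_of_odd (by decide)
  have h2 := gaussianMoment_add_two 0
  have h4 := gaussianMoment_add_two 2
  have h6 := gaussianMoment_add_two 4
  have h8 := gaussianMoment_add_two 6
  have h10 := gaussianMoment_add_two 8
  have h12 := gaussianMoment_add_two 10
  norm_num [Nat.choose] at *
  simp only [h1, h3, h5, h12, h10, h8, h6, h4, h2]
  have hq2 : q ^ 2 = 1 - p ^ 2 := by linarith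
  have hq4 : q ^ 4 = (1 - p ^ 2) ^ 2 := by rw [← hq2]; ring
  have hq6 : q ^ 6 = (1 - p ^ 2) ^ 3 := by rw [← hq2]; ring
  rw [hq2, hq4, hq6]
  ring

end TwoCoordinates

lemma exists_orthonormalBasis_two_coordinates {n : ℕ} (b c : EuclideanSpace ℝ (Fin (n + 2))) :
    ∃ B : OrthonormalBasis (Fin (n + 2)) ℝ (EuclideanSpace ℝ (Fin (n + 2))),
      (∀ j, j ≠ 0 → B.repr b j = 0) ∧ ∀ j, j ≠ 0 → j ≠ 1 → B.repr c j = 0 := by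
  let f : Fin (n + 2) → EuclideanSpace ℝ (Fin (n + 2)) := Fin.cons b (fun _ => c)
  have hrank : Module.finrank ℝ (EuclideanSpace ℝ (Fin (n + 2))) = Fintype.card (Fin (n + 2)) := by
    simp
  refine ⟨InnerProductSpace.gramSchmidtOrthonormalBasis hrank f, fun j h0 => ?_, fun j h0 h1 => ?_⟩
  · exact InnerProductSpace.gramSchmidtOrthonormalBasis_inv_triangular' hrank f (i := 0)
      (Fin.pos_of_ne_zero h0)
  · refine InnerProductSpace.gramSchmidtOrthonormalBasis_inv_triangular' hrank f (i := 1) ?_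
    simp only [ne_eq, Fin.ext_iff, Fin.lt_def, Fin.val_zero, Fin.val_one] at *
    omega

lemma integral_inner_pow_six_mul_gaussian {n : ℕ} {b c : EuclideanSpace ℝ (Fin (n + 2))}
    (hb : ‖b‖ = 1) (hc : ‖c‖ = 1) :
    ∫ x, ⟪b, x⟫_ℝ ^ 6 * ⟪c, x⟫_ℝ ^ 6 * exp (-(1 / 2) * ‖x‖ ^ 2) =
      (720 * ⟪b, c⟫_ℝ ^ 6 + 5400 * ⟪b, c⟫_ℝ ^ 4 + 4050 * ⟪b, c⟫_ℝ ^ 2 + 225) *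
        gaussianMoment 0 ^ (n + 2) := by
  obtain ⟨B, hB, hC⟩ := exists_orthonormalBasis_two_coordinates b c
  have hb' (x) : ⟪b, x⟫_ℝ = B.repr b 0 * B.repr x 0 := by
    rw [← B.repr.inner_map_map, PiLp.inner_apply, Fin.sum_univ_succ,
      Finset.sum_eq_zero fun i _ => by simp [hB _ (Fin.succ_ne_zero i)]]
    simp [mul_comm]
  have hc' (x) : ⟪c, x⟫_ℝ = B.repr c 0 * B.repr x 0 + B.repr c 1 * B.repr x 1 := by
    rw [← B.repr.inner_map_map, PiLp.inner_apply, Fin.sum_univ_succ, Fin.sum_univ_succ,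
      Finset.sum_eq_zero fun i _ => by
        simp [hC i.succ.succ (Fin.succ_ne_zero _) (by simp [Fin.ext_iff])]]
    simp [mul_comm]
  have hb2 : B.repr b 0 ^ 2 = 1 := by
    rw [sq, ← hb', real_inner_self_eq_norm_sq, hb, one_pow]
  have hc2 : B.repr c 0 ^ 2 + B.repr c 1 ^ 2 = 1 := by
    rw [sq, sq, ← hc', real_inner_self_eq_norm_sq, hc, one_pow]
  have hpow (y : ℝ) : (B.repr b 0 * y) ^ 2 = y ^ 2 := by rw [mul_pow, hb2, one_mul]
  have hpow4 (y : ℝ) : (B.repr b 0 * y) ^ 4 = y ^ 4 := by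
    rw [pow_mul _ 2 2, hpow, ← pow_mul]
  have hpow6 (y : ℝ) : (B.repr b 0 * y) ^ 6 = y ^ 6 := by
    rw [pow_mul _ 2 3, hpow, ← pow_mul]
  rw [hb' c, hpow, hpow4, hpow6, ← integral_pow_six_mul_linear_pow_six_mul_gaussian hc2,
    ← B.measurePreserving_repr.integral_comp B.repr.toHomeomorph.measurableEmbedding
      (fun x => x 0 ^ 6 * (B.repr c 0 * x 0 + B.repr c 1 * x 1) ^ 6 * exp (-(1 / 2) * ‖x‖ ^ 2))]
  simp only [hb', hc', hpow6, LinearIsometryEquiv.norm_map]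

lemma integral_homogeneous_mul_radial {E : Type*} [NormedAddCommGroup E] [NormedSpace ℝ E]
    [MeasurableSpace E] [BorelSpace E] [FiniteDimensional ℝ E] [Nontrivial E]
    (μ : Measure E) [μ.IsAddHaarMeasure] {f : E → ℝ} {k : ℕ}
    (hf : ∀ r : ℝ, 0 < r → ∀ x, f (r • x) = r ^ k * f x) (g : ℝ → ℝ) :
    ∫ x, f x * g ‖x‖ ∂μ =
      (∫ u : Metric.sphere (0 : E) 1, f u ∂μ.toSphere) *
        ∫ r in Set.Ioi (0 : ℝ), r ^ (Module.finrank ℝ E - 1 + k) * g r := by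
  calc
    ∫ x, f x * g ‖x‖ ∂μ
      = ∫ x : ({0}ᶜ : Set E), f x * g ‖x.1‖ ∂(μ.comap (↑)) := by
      rw [integral_subtype_comap (measurableSet_singleton _).compl fun x => f x * g ‖x‖,
        restrict_compl_singleton]
    _ = ∫ y : Metric.sphere (0 : E) 1 × Set.Ioi (0 : ℝ), f y.1 * (y.2.1 ^ k * g y.2)
          ∂μ.toSphere.prod (.volumeIoiPow (Module.finrank ℝ E - 1)) := by
      rw [← μ.measurePreserving_homeomorphUnitSphereProd.integral_comp
        (Homeomorph.measurableEmbedding _)]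
      refine integral_congr_ae (.of_forall fun x => ?_)
      have hx : 0 < ‖x.1‖ := norm_pos_iff.2 x.2
      have h := hf ‖x.1‖ hx (‖x.1‖⁻¹ • x.1)
      rw [smul_inv_smul₀ hx.ne'] at h
      simp only [homeomorphUnitSphereProd_apply_fst_coe, homeomorphUnitSphereProd_apply_snd_coe]
      rw [h]
      ring
    _ = (∫ u : Metric.sphere (0 : E) 1, f u ∂μ.toSphere) *
          ∫ r : Set.Ioi (0 : ℝ), r.1 ^ k * g r ∂.volumeIoiPow (Module.finrank ℝ E - 1) :=
      integral_prod_mul (fun u : Metric.sphere (0 : E) 1 => f u)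
        (fun r : Set.Ioi (0 : ℝ) => r.1 ^ k * g r)
    _ = _ := by
      simp only [Measure.volumeIoiPow, ENNReal.ofReal]
      rw [integral_withDensity_eq_integral_smul,
        integral_subtype_comap measurableSet_Ioi fun a =>
          Real.toNNReal (a ^ (Module.finrank ℝ E - 1)) • (a ^ k * g a),
        setIntegral_congr_fun measurableSet_Ioi fun x hx => ?_]
      · rw [NNReal.smul_def, Real.coe_toNNReal _ (pow_nonneg hx.out.le _), smul_eq_mul,
          pow_add, mul_assoc]
      · exact (measurable_subtype_coe.pow_const _).real_toNNReal

/-- Mixed moment formula for projections of a uniform random vector on the sphere. -/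
theorem eta_six (d : ℕ) (hd : 2 ≤ d)
    (b c : Metric.sphere (0 : EuclideanSpace ℝ (Fin d)) 1) :
    unifExp d (fun u => ⟪(b : EuclideanSpace ℝ (Fin d)), (u : EuclideanSpace ℝ (Fin d))⟫_ℝ ^ 6 * ⟪(c : EuclideanSpace ℝ (Fin d)), (u : EuclideanSpace ℝ (Fin d))⟫_ℝ ^ 6)
      = (720 * ⟪(b : EuclideanSpace ℝ (Fin d)), (c : EuclideanSpace ℝ (Fin d))⟫_ℝ ^ 6 + 5400 * ⟪(b : EuclideanSpace ℝ (Fin d)), (c : EuclideanSpace ℝ (Fin d))⟫_ℝ ^ 4 + 4050 * ⟪(b : EuclideanSpace ℝ (Fin d)), (c : EuclideanSpace ℝ (Fin d))⟫_ℝ ^ 2 + 225) / ((d : ℝ) * ((d : ℝ) + 2) * ((d : ℝ) + 4) * ((d : ℝ) + 6) * ((d : ℝ) + 8) * ((d : ℝ) + 10)) := by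
  obtain ⟨n, rfl⟩ := Nat.exists_eq_add_of_le' hd
  have hsix := integral_homogeneous_mul_radial
    (volume : Measure (EuclideanSpace ℝ (Fin (n + 2)))) (k := 12)
    (f := fun x => ⟪(b : EuclideanSpace ℝ (Fin (n + 2))), x⟫_ℝ ^ 6 *
      ⟪(c : EuclideanSpace ℝ (Fin (n + 2))), x⟫_ℝ ^ 6)
    (fun r _ x => by simp only [real_inner_smul_right]; ring) fun r => exp (-(1 / 2) * r ^ 2)
  have hone := integral_homogeneous_mul_radial
    (volume : Measure (EuclideanSpace ℝ (Fin (n + 2)))) (k := 0) (f := fun _ => 1)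
    (fun r _ x => by simp) fun r => exp (-(1 / 2) * r ^ 2)
  have hmass := integral_pow_mul_pow_mul_gaussian (n := n) 0 0
  simp only [pow_zero, mul_one] at hmass
  rw [integral_inner_pow_six_mul_gaussian (norm_eq_of_mem_sphere b) (norm_eq_of_mem_sphere c),
    finrank_euclideanSpace_fin, ← halfGaussianMoment] at hsix
  rw [hmass, finrank_euclideanSpace_fin, ← halfGaussianMoment, integral_const, smul_eq_mul,
    mul_one] at hone
  have hradial : halfGaussianMoment (n + 2 - 1 + 12) =
      (n + 2) * (n + 4) * (n + 6) * (n + 8) * (n + 10) * (n + 12) *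
        halfGaussianMoment (n + 2 - 1 + 0) := by
    simp only [Nat.add_one_sub_one, add_zero, halfGaussianMoment_add_two (n + 1),
      halfGaussianMoment_add_two (n + 1 + 2), halfGaussianMoment_add_two (n + 1 + 4),
      halfGaussianMoment_add_two (n + 1 + 6), halfGaussianMoment_add_two (n + 1 + 8),
      halfGaussianMoment_add_two (n + 1 + 10)]
    push_cast
    ring
  have hR := halfGaussianMoment_pos (n + 2 - 1 + 0)
  have hZ : 0 < gaussianMoment 0 := by
    rw [gaussianMoment_of_even Even.zero]
    exact mul_pos two_pos (halfGaussianMoment_pos 0)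
  rw [hradial] at hsix
  simp only [unifExp, sphereMeasure, ← measureReal_def]
  set I := ∫ u : Metric.sphere (0 : EuclideanSpace ℝ (Fin (n + 2))) 1,
    ⟪(b : EuclideanSpace ℝ (Fin (n + 2))), (u : EuclideanSpace ℝ (Fin (n + 2)))⟫_ℝ ^ 6 *
      ⟪(c : EuclideanSpace ℝ (Fin (n + 2))), (u : EuclideanSpace ℝ (Fin (n + 2)))⟫_ℝ ^ 6
    ∂(volume : Measure (EuclideanSpace ℝ (Fin (n + 2)))).toSphere
  set s := (volume : Measure (EuclideanSpace ℝ (Fin (n + 2)))).toSphere.real Set.univ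
  set R := halfGaussianMoment (n + 2 - 1 + 0)
  have hs : 0 < s := by
    refine pos_of_mul_pos_left ?_ hR.le
    rw [← hone]
    positivity
  have hpow : gaussianMoment 0 ^ (n + 2) = s * R := by rw [← hone]; ring
  rw [hpow] at hsix
  push_cast
  rw [inv_mul_eq_div, div_eq_div_iff hs.ne' (by positivity)]
  refine mul_right_cancel₀ hR.ne' ?_
  linear_combination -hsix
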